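/- arXiv:1210.0740 — 3 statements merged into one kernel-verified Lean document; each statement's English description precedes it below -/
import Mathlib

section
/- Let ε > 0 and let h be a smooth non-negative function on ℝ supported on the interval (1,2) with bounded derivatives. There exists a constant C depending only on h and ε such that for every real K ≥ 2 and all reals x, y with K^{4/3−ε} < x < K^{2−ε} and x K^{−ε} < y < x K^{ε}, one has |∑_{k ≥ 2 even} i^k h(k/K) J_{k−1}(4πx) J_{2k−1}(4πy)| ≤ C · K/√(xy). -/
noncomputable section

/-- e(x) = exp(2πi x) -/
def ee (x : ℝ) : ℂ := Complex.exp (2 * Real.pi * Complex.I * x)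

/-- Bessel function of integer order: J_ℓ(x) = ∫_{-1/2}^{1/2} e(ℓt) e^{-ix sin(2πt)} dt -/
def besselJ (ℓ : ℕ) (x : ℝ) : ℂ :=
  ∫ t in (-(1:ℝ)/2)..(1/2), ee (ℓ * t) * Complex.exp (-Complex.I * x * Real.sin (2 * Real.pi * t))

/-- Kloosterman sum S(n,m;c) -/
def kloos (n m : ℤ) (c : ℕ) : ℂ :=
  ∑ b ∈ Finset.range c, if Nat.Coprime b c then
    ee (((((n : ZMod c) * (b : ZMod c) + (m : ZMod c) * (b : ZMod c)⁻¹).val : ℕ) : ℝ) / c)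
  else 0

/-- Λ_{k,j}(s) -/
def Lam (j : ℕ) (k : ℝ) (s : ℂ) : ℂ :=
  if j = 1 then (2 * Real.pi : ℂ) ^ (-s) * Complex.Gamma (s + (k : ℂ) - 1/2)
  else 8 * (2 * Real.pi : ℂ) ^ (-3*s - 3*(k:ℂ) + 3/2) * Complex.Gamma (s + 2*(k:ℂ) - 3/2) *
    Complex.Gamma (s + (k:ℂ) - 1/2) * Complex.Gamma (s + 1/2)

/-- V_{k,j}(ξ), contour integral on Re s = 1 -/
def V (j : ℕ) (k : ℝ) (ξ : ℝ) : ℂ :=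
  (1 / (2 * Real.pi * Complex.I)) * ∫ t : ℝ,
    (Lam j k (1/2 + (1 + (t:ℂ) * Complex.I)) / Lam j k (1/2)) *
      (ξ : ℂ) ^ (-(1 + (t:ℂ) * Complex.I)) / (1 + (t:ℂ) * Complex.I) * Complex.I

/-- Fourier transform ĥ(t) = ∫ h(v) e(−vt) dv -/
def fhat (h : ℝ → ℂ) (t : ℝ) : ℂ := ∫ v : ℝ, h v * ee (-(v * t))

end


lemma aux_cont (ℓ : ℕ) (x : ℝ) : Continuous (fun t : ℝ => ee (ℓ * t) *
    Complex.exp (-Complex.I * x * Real.sin (2 * Real.pi * t))) := by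
  unfold ee
  fun_prop

lemma aux_seq (a : ℕ → ℝ) (x : ℝ) (hx : 2 ≤ x)
    (hrec : ∀ n : ℕ, a n + a (n + 2) = (2 * ((n : ℝ) + 1) / x) * a (n + 1))
    (hsum : ∀ S : Finset ℕ, ∑ n ∈ S, a n ^ 2 ≤ 1) (m : ℕ) (hm : (m : ℝ) + 1 ≤ x / 2) :
    a m ^ 2 ≤ 72 / x := by
  have hx0 : 0 < x := by linarith
  set c : ℕ → ℝ := fun n => 2 * ((n : ℝ) + 1) / x with hc
  set Q : ℕ → ℝ := fun n => a n ^ 2 + a (n + 1) ^ 2 - c n * a n * a (n + 1) with hQ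
  have hc0 : ∀ n, 0 ≤ c n := fun n => by simp only [hc]; positivity
  have hc1 : ∀ n : ℕ, (n : ℝ) + 1 ≤ x / 2 → c n ≤ 1 := fun n hn => by
    simp only [hc]; rw [div_le_one hx0]; linarith
  have hcs : ∀ n, c (n + 1) = c n + 2 / x := fun n => by
    simp only [hc]; push_cast; field_simp
  have key : ∀ t u v : ℝ, 0 ≤ t → t ≤ 1 → (u ^ 2 + v ^ 2) / 2 ≤ u ^ 2 + v ^ 2 - t * u * v ∧
      u ^ 2 + v ^ 2 - t * u * v ≤ 3 / 2 * (u ^ 2 + v ^ 2) := by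
    intro t u v h0 h1
    constructor
    · nlinarith [mul_nonneg h0 (sq_nonneg (u - v)), mul_nonneg (sub_nonneg.2 h1) (add_nonneg (sq_nonneg u) (sq_nonneg v))]
    · nlinarith [mul_nonneg h0 (sq_nonneg (u + v)), mul_nonneg (sub_nonneg.2 h1) (add_nonneg (sq_nonneg u) (sq_nonneg v))]
  have hQ' : ∀ n, Q n = a (n + 1) ^ 2 + a (n + 2) ^ 2 - c n * a (n + 1) * a (n + 2) := by
    intro n
    have h1 : a n = c n * a (n + 1) - a (n + 2) := by
      have := hrec n
      simp only [hc]; linarith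
    simp only [hQ]; rw [h1]; ring
  have hQs : ∀ n, Q (n + 1) = Q n - 2 / x * (a (n + 1) * a (n + 2)) := by
    intro n
    rw [hQ' n]; simp only [hQ]; rw [hcs]; ring
  set r : ℝ := 1 + 2 / x with hr
  have h2x : 0 < 2 / x := by positivity
  have hr1 : 1 ≤ r := by linarith
  have hstep : ∀ n : ℕ, ((n + 1 : ℕ) : ℝ) + 1 ≤ x / 2 → Q (n + 1) ≤ r * Q n ∧ Q n ≤ r * Q (n + 1) := by
    intro n hn
    have e1 := (key (c (n + 1)) (a (n + 1)) (a (n + 2)) (hc0 _) (hc1 _ hn)).1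
    have e2 := (key (c n) (a (n + 1)) (a (n + 2)) (hc0 _) (by have := hcs n; have := hc1 _ hn; linarith)).1
    have e3 := hQs n
    rw [← hQ' n] at e2
    change _ ≤ Q (n + 1) at e1
    have p1 : a (n + 1) * a (n + 2) ≤ (a (n + 1) ^ 2 + a (n + 2) ^ 2) / 2 := by nlinarith [sq_nonneg (a (n + 1) - a (n + 2))]
    have p2 : -(a (n + 1) * a (n + 2)) ≤ (a (n + 1) ^ 2 + a (n + 2) ^ 2) / 2 := by nlinarith [sq_nonneg (a (n + 1) + a (n + 2))]
    have q1 := mul_le_mul_of_nonneg_left (p2.trans e2) h2x.le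
    have q2 := mul_le_mul_of_nonneg_left (p1.trans e1) h2x.le
    constructor <;> (rw [hr]; linarith)
  set N : ℕ := ⌊x / 2⌋₊ with hN
  have hNx : (N : ℝ) ≤ x / 2 := Nat.floor_le (by positivity)
  have hNl : x / 4 ≤ N := by
    have h1 : x / 2 < N + 1 := Nat.lt_floor_add_one _
    have h2 : 1 ≤ N := Nat.le_floor (by push_cast; linarith)
    have h2' : (1 : ℝ) ≤ N := by exact_mod_cast h2
    linarith
  have hQnn : ∀ n : ℕ, n < N → 0 ≤ Q n ∧ a n ^ 2 ≤ 2 * Q n ∧ Q n ≤ 3 / 2 * (a n ^ 2 + a (n + 1) ^ 2) := by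
    intro n hn
    have : (n : ℝ) + 1 ≤ N := by exact_mod_cast hn
    have e := key (c n) (a n) (a (n + 1)) (hc0 _) (hc1 _ (by linarith))
    have e1 : (a n ^ 2 + a (n + 1) ^ 2) / 2 ≤ Q n := e.1
    refine ⟨?_, ?_, e.2⟩ <;> nlinarith [sq_nonneg (a n), sq_nonneg (a (n + 1))]
  have hup : ∀ d n : ℕ, n + d < N → Q (n + d) ≤ r ^ d * Q n ∧ Q n ≤ r ^ d * Q (n + d) := by
    intro d
    induction d with
    | zero => intro n _; simp
    | succ d ih =>
      intro n hn
      have i := ih n (by omega)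
      have : ((n + d + 1 : ℕ) : ℝ) + 1 ≤ N := by exact_mod_cast hn
      have s := hstep (n + d) (by linarith)
      rw [← add_assoc, pow_succ]
      have rp : 0 ≤ r ^ d := by positivity
      constructor
      · nlinarith [mul_le_mul_of_nonneg_left i.1 (show 0 ≤ r by linarith)]
      · nlinarith [mul_le_mul_of_nonneg_left s.2 rp]
  have hrN : ∀ d : ℕ, d < N → r ^ d ≤ 3 := by
    intro d hd
    have hd' : (d : ℝ) ≤ x / 2 := le_trans (by exact_mod_cast hd.le) hNx
    calc r ^ d ≤ (Real.exp (2 / x)) ^ d := by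
          gcongr
          rw [hr, add_comm]; exact Real.add_one_le_exp _
      _ = Real.exp (d * (2 / x)) := by rw [← Real.exp_nat_mul]
      _ ≤ Real.exp 1 := by
          apply Real.exp_le_exp.2
          rw [← mul_div_assoc, div_le_one hx0]; linarith
      _ ≤ 3 := by have := Real.exp_one_lt_d9; linarith
  have hmN : m < N := by
    have : m + 1 ≤ N := Nat.le_floor (by push_cast; exact hm)
    omega
  have hcomp : ∀ n ∈ Finset.range N, Q m ≤ 3 * Q n := by
    intro n hn
    have hn := Finset.mem_range.1 hn
    have hn0 := (hQnn n hn).1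
    rcases le_total n m with h | h
    · obtain ⟨d, rfl⟩ := Nat.exists_eq_add_of_le h
      exact (hup d n hmN).1.trans (mul_le_mul_of_nonneg_right (hrN d (by omega)) hn0)
    · obtain ⟨d, rfl⟩ := Nat.exists_eq_add_of_le h
      exact (hup d m hn).2.trans (mul_le_mul_of_nonneg_right (hrN d (by omega)) hn0)
  have hs1 : (N : ℝ) * Q m ≤ ∑ n ∈ Finset.range N, 3 * Q n := by
    have := Finset.sum_le_sum hcomp
    simpa using this
  have hs2 : ∑ n ∈ Finset.range N, 3 * Q n ≤ 9 := by
    have h1 : ∑ n ∈ Finset.range N, 3 * Q n ≤ ∑ n ∈ Finset.range N, 9 / 2 * (a n ^ 2 + a (n + 1) ^ 2) := by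
      apply Finset.sum_le_sum
      intro n hn
      have := (hQnn n (Finset.mem_range.1 hn)).2.2
      linarith
    rw [← Finset.mul_sum (Finset.range N) (fun n => a n ^ 2 + a (n + 1) ^ 2), Finset.sum_add_distrib] at h1
    have h2 := hsum (Finset.range N)
    have h3 := hsum (Finset.range (N + 1))
    rw [Finset.sum_range_succ'] at h3
    nlinarith [sq_nonneg (a 0)]
  have hm0 := hQnn m hmN
  rw [le_div_iff₀ hx0]
  nlinarith [mul_le_mul_of_nonneg_right hNl hm0.1]

lemma aux_rec (x : ℝ) (hx : 0 < x) (n : ℕ) :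
    besselJ n x + besselJ (n + 2) x = ((2 * ((n : ℝ) + 1) / x : ℝ) : ℂ) * besselJ (n + 1) x := by
  have hd : ∀ t : ℝ, HasDerivAt (fun t : ℝ => ee (((n + 1 : ℕ) : ℝ) * t) *
      Complex.exp (-Complex.I * x * Real.sin (2 * Real.pi * t)))
      ((2 * Real.pi * Complex.I) * (((n : ℂ) + 1) * (ee (((n + 1 : ℕ) : ℝ) * t) *
      Complex.exp (-Complex.I * x * Real.sin (2 * Real.pi * t))) - (x / 2 : ℂ) *
        (ee ((n : ℝ) * t) * Complex.exp (-Complex.I * x * Real.sin (2 * Real.pi * t)) +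
        ee (((n + 2 : ℕ) : ℝ) * t) * Complex.exp (-Complex.I * x * Real.sin (2 * Real.pi * t))))) t := by
    intro t
    have h1 : HasDerivAt (fun t : ℝ => 2 * Real.pi * t) (2 * Real.pi) t := by
      simpa using (hasDerivAt_id t).const_mul (2 * Real.pi)
    have h2 := ((h1.sin.ofReal_comp).const_mul (-Complex.I * x)).cexp
    have h3 : HasDerivAt (fun t : ℝ => ee (((n + 1 : ℕ) : ℝ) * t))
        (ee (((n + 1 : ℕ) : ℝ) * t) * (2 * Real.pi * Complex.I * ((n : ℂ) + 1))) t := by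
      unfold ee
      have h4 : HasDerivAt (fun t : ℝ => ((n + 1 : ℕ) : ℝ) * t) ((n + 1 : ℕ) : ℝ) t := by
        simpa using (hasDerivAt_id t).const_mul (((n + 1 : ℕ) : ℝ))
      have := ((h4.ofReal_comp).const_mul (2 * Real.pi * Complex.I)).cexp
      simpa using this
    refine (h3.mul h2).congr_deriv ?_
    have e1 : ee ((n : ℝ) * t) = ee (((n + 1 : ℕ) : ℝ) * t) * Complex.exp (-(2 * Real.pi * t) * Complex.I) := by
      unfold ee
      rw [← Complex.exp_add]; congr 1; push_cast; ring
    have e2 : ee (((n + 2 : ℕ) : ℝ) * t) = ee (((n + 1 : ℕ) : ℝ) * t) * Complex.exp ((2 * Real.pi * t) * Complex.I) := by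
      unfold ee
      rw [← Complex.exp_add]; congr 1; push_cast; ring
    have e3 : ((Real.cos (2 * Real.pi * t) : ℝ) : ℂ) = (Complex.exp ((2 * Real.pi * t) * Complex.I) + Complex.exp (-(2 * Real.pi * t) * Complex.I)) / 2 := by
      push_cast
      rw [Complex.cos]
    rw [e1, e2]
    push_cast [e3]
    ring
  have hI : ∀ ℓ : ℕ, IntervalIntegrable (fun t : ℝ => ee (ℓ * t) *
    Complex.exp (-Complex.I * x * Real.sin (2 * Real.pi * t))) MeasureTheory.volume (-(1:ℝ)/2) (1/2) :=
    fun ℓ => (aux_cont ℓ x).intervalIntegrable _ _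
  have hF := intervalIntegral.integral_eq_sub_of_hasDerivAt (a := -(1:ℝ)/2) (b := 1/2) (fun t _ => hd t)
    ((((hI (n+1)).const_mul _).sub (((hI n).add (hI (n+2))).const_mul _)).const_mul _)
  rw [intervalIntegral.integral_const_mul, intervalIntegral.integral_sub
    ((hI (n+1)).const_mul _) (((hI n).add (hI (n+2))).const_mul _),
    intervalIntegral.integral_const_mul, intervalIntegral.integral_const_mul,
    intervalIntegral.integral_add (hI n) (hI (n+2))] at hF
  change _ * (_ * besselJ (n+1) x - _ * (besselJ n x + besselJ (n+2) x)) = _ at hF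
  have hb : ee (((n + 1 : ℕ) : ℝ) * (1/2)) = ee (((n + 1 : ℕ) : ℝ) * (-(1:ℝ)/2)) := by
    unfold ee
    rw [Complex.exp_eq_exp_iff_exists_int]
    refine ⟨(n : ℤ) + 1, ?_⟩
    push_cast; ring
  have hs1 : Real.sin (2 * Real.pi * (1/2)) = 0 := by
    rw [show 2 * Real.pi * (1/2) = Real.pi by ring]; simp
  have hs2 : Real.sin (2 * Real.pi * (-(1:ℝ)/2)) = 0 := by
    rw [show 2 * Real.pi * (-(1:ℝ)/2) = -Real.pi by ring]; simp
  rw [hb, hs1, hs2, sub_self] at hF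
  have hpi : (2 * Real.pi * Complex.I : ℂ) ≠ 0 := Complex.two_pi_I_ne_zero
  have hF' := (mul_eq_zero.1 hF).resolve_left hpi
  have hxc : (x : ℂ) ≠ 0 := by exact_mod_cast hx.ne'
  push_cast
  field_simp
  linear_combination -2 * hF'

lemma aux_bessel (x : ℝ) (S : Finset ℕ) : ∑ n ∈ S, ‖besselJ n x‖ ^ 2 ≤ 1 := by
  have hab : (-(1:ℝ)/2) < 1/2 := by norm_num
  set f : ℝ → ℂ := fun t => Complex.exp (-Complex.I * x * Real.sin (2 * Real.pi * t)) with hf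
  have hfc : Continuous f := by rw [hf]; fun_prop
  have hn : ∀ t, ‖f t‖ = 1 := by
    intro t
    simp only [hf]
    rw [show -Complex.I * x * Real.sin (2 * Real.pi * t) = ((-(x * Real.sin (2 * Real.pi * t)) : ℝ) : ℂ) * Complex.I by push_cast; ring]
    exact Complex.norm_exp_ofReal_mul_I _
  have hL2 : MeasureTheory.MemLp f 2 (MeasureTheory.volume.restrict (Set.Ioc (-(1:ℝ)/2) (1/2))) := by
    apply MeasureTheory.MemLp.of_bound hfc.aestronglyMeasurable 1
    exact Filter.Eventually.of_forall fun t => (hn t).le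
  have hP := hasSum_sq_fourierCoeffOn hab hL2
  have hv : (1 / ((1:ℝ)/2 - -(1:ℝ)/2)) • ∫ t in (-(1:ℝ)/2)..(1/2), ‖f t‖ ^ 2 = 1 := by
    simp only [hn]; norm_num
  have hco : ∀ n : ℕ, besselJ n x = fourierCoeffOn hab f (-(n : ℤ)) := by
    intro n
    rw [fourierCoeffOn_eq_integral]
    unfold besselJ
    have : (1 / ((1:ℝ)/2 - -(1:ℝ)/2)) = 1 := by norm_num
    rw [this, one_smul]
    apply intervalIntegral.integral_congr
    intro t _
    simp only [neg_neg, smul_eq_mul, hf, fourier_coe_apply]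
    congr 1
    unfold ee
    congr 1
    push_cast
    norm_num
    ring
  have hinj : Function.Injective (fun n : ℕ => -(n : ℤ)) := fun a b h => by simpa using h
  have := sum_le_hasSum (S.map ⟨_, hinj⟩) (fun i _ => sq_nonneg _) hP
  rw [Finset.sum_map] at this
  simp only [Function.Embedding.coeFn_mk, ← hco] at this
  rw [← one_div, hv] at this
  exact this

lemma aux_point (x : ℝ) (hx : 2 ≤ x) (m : ℕ) (hm : (m : ℝ) + 1 ≤ x / 2) :
    ‖besselJ m x‖ ^ 2 ≤ 144 / x := by
  have hx0 : 0 < x := by linarith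
  have hsq : ∀ z : ℂ, ‖z‖ ^ 2 = z.re ^ 2 + z.im ^ 2 := by
    intro z; rw [← Complex.normSq_eq_norm_sq, Complex.normSq_apply]; ring
  have h1 := aux_seq (fun n => (besselJ n x).re) x hx
    (fun n => by
      have := congrArg Complex.re (aux_rec x hx0 n)
      rw [Complex.re_ofReal_mul] at this
      simpa using this)
    (fun S => le_trans (Finset.sum_le_sum fun n _ => by rw [hsq]; nlinarith [sq_nonneg (besselJ n x).im]) (aux_bessel x S)) m hm
  have h2 := aux_seq (fun n => (besselJ n x).im) x hx
    (fun n => by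
      have := congrArg Complex.im (aux_rec x hx0 n)
      rw [Complex.im_ofReal_mul] at this
      simpa using this)
    (fun S => le_trans (Finset.sum_le_sum fun n _ => by rw [hsq]; nlinarith [sq_nonneg (besselJ n x).re]) (aux_bessel x S)) m hm
  rw [hsq]
  have : 144 / x = 72 / x + 72 / x := by ring
  linarith

lemma aux_mean (x L : ℝ) (hx : 0 < x) (hL : 1 ≤ L) (S : Finset ℕ) (g : ℕ → ℕ)
    (hg : Set.InjOn g S) (hS : ∀ k ∈ S, ((g k : ℕ) : ℝ) + 1 ≤ L) :
    ∑ k ∈ S, ‖besselJ (g k) x‖ ^ 2 ≤ 144 * L / x := by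
  rw [← Finset.sum_image (f := fun n => ‖besselJ n x‖ ^ 2) hg]
  rcases le_total (2 * L) x with h | h
  · have hcard : (((S.image g).card : ℕ) : ℝ) ≤ L := by
      have hsub : S.image g ⊆ Finset.range ⌊L⌋₊ := by
        intro n hn
        obtain ⟨k, hk, rfl⟩ := Finset.mem_image.1 hn
        rw [Finset.mem_range]
        exact Nat.le_floor (by push_cast; exact hS k hk)
      have := Finset.card_le_card hsub
      rw [Finset.card_range] at this
      exact le_trans (by exact_mod_cast this) (Nat.floor_le (by linarith))
    calc _ ≤ ∑ n ∈ S.image g, 144 / x := by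
          apply Finset.sum_le_sum
          intro n hn
          obtain ⟨k, hk, rfl⟩ := Finset.mem_image.1 hn
          exact aux_point x (by linarith) _ (by have := hS k hk; linarith)
      _ = (S.image g).card * (144 / x) := by simp
      _ ≤ L * (144 / x) := by gcongr
      _ = _ := by ring
  · refine (aux_bessel x _).trans ?_
    rw [le_div_iff₀ hx]; linarith

theorem stmt1 (ε : ℝ) (hε : 0 < ε) (h : ℝ → ℝ)
    (hsm : ContDiff ℝ (⊤ : ℕ∞) h) (hnn : ∀ u, 0 ≤ h u)
    (hsupp : Function.support h ⊆ Set.Ioo 1 2)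
    (hbd : ∀ B : ℕ, ∃ M : ℝ, ∀ u, |iteratedDeriv B h u| ≤ M) :
    ∃ C : ℝ, ∀ K x y : ℝ, 2 ≤ K →
      K ^ ((4:ℝ)/3 - ε) < x → x < K ^ ((2:ℝ) - ε) →
      x * K ^ (-ε) < y → y < x * K ^ ε →
      ‖∑' k : ℕ, if Even k ∧ 2 ≤ k then
          Complex.I ^ k * (h ((k : ℝ) / K) : ℂ) * besselJ (k - 1) (4 * Real.pi * x) *
            besselJ (2 * k - 1) (4 * Real.pi * y) else 0‖
        ≤ C * K / Real.sqrt (x * y) := by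
  obtain ⟨M, hM⟩ := hbd 0
  simp only [iteratedDeriv_zero] at hM
  have hM0 : 0 ≤ M := (abs_nonneg _).trans (hM 0)
  refine ⟨144 * M, ?_⟩
  intro K x y hK hx _ hy _
  have hK0 : 0 < K := by linarith
  have hx0 : 0 < x := lt_trans (Real.rpow_pos_of_pos hK0 _) hx
  have hy0 : 0 < y := lt_trans (mul_pos hx0 (Real.rpow_pos_of_pos hK0 _)) hy
  have hpi := Real.pi_gt_three
  set S : Finset ℕ := (Finset.range ⌈2 * K⌉₊).filter (fun k => 1 ≤ k) with hSdef
  have hS : ∀ k ∈ S, 1 ≤ k ∧ (k : ℝ) ≤ 2 * K := by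
    intro k hk
    rw [hSdef, Finset.mem_filter, Finset.mem_range] at hk
    exact ⟨hk.2, (Nat.lt_ceil.1 hk.1).le⟩
  have hA : ∑ k ∈ S, ‖besselJ (k - 1) (4 * Real.pi * x)‖ ^ 2 ≤ 144 * (K / x) := by
    refine (aux_mean (4 * Real.pi * x) (2 * K) (by positivity) (by linarith) S (fun k => k - 1) ?_ ?_).trans ?_
    · intro a ha b hb hab
      have := (hS a ha).1
      have := (hS b hb).1
      simp only at hab
      omega
    · intro k hk
      have := hS k hk
      rw [Nat.cast_sub this.1]; push_cast; linarith
    · rw [← mul_div_assoc, div_le_div_iff₀ (by positivity) hx0]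
      nlinarith [mul_pos hK0 hx0]
  have hB : ∑ k ∈ S, ‖besselJ (2 * k - 1) (4 * Real.pi * y)‖ ^ 2 ≤ 144 * (K / y) := by
    refine (aux_mean (4 * Real.pi * y) (4 * K) (by positivity) (by linarith) S (fun k => 2 * k - 1) ?_ ?_).trans ?_
    · intro a ha b hb hab
      have := (hS a ha).1
      have := (hS b hb).1
      simp only at hab
      omega
    · intro k hk
      have := hS k hk
      rw [Nat.cast_sub (by omega)]; push_cast; linarith
    · rw [← mul_div_assoc, div_le_div_iff₀ (by positivity) hy0]
      nlinarith [mul_pos hK0 hy0]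
  rw [tsum_eq_sum (s := S)]
  · have h1 : ∀ k ∈ S, ‖(if Even k ∧ 2 ≤ k then
          Complex.I ^ k * (h ((k : ℝ) / K) : ℂ) * besselJ (k - 1) (4 * Real.pi * x) *
            besselJ (2 * k - 1) (4 * Real.pi * y) else 0)‖ ≤
          M * (‖besselJ (k - 1) (4 * Real.pi * x)‖ * ‖besselJ (2 * k - 1) (4 * Real.pi * y)‖) := by
      intro k _
      split_ifs
      · rw [norm_mul, norm_mul, norm_mul, norm_pow, Complex.norm_I, one_pow, one_mul, Complex.norm_real,
          Real.norm_eq_abs, mul_assoc]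
        exact mul_le_mul_of_nonneg_right (hM _) (by positivity)
      · rw [norm_zero]; positivity
    refine (norm_sum_le_of_le S h1).trans ?_
    rw [← Finset.mul_sum]
    have hcs := Real.sum_mul_le_sqrt_mul_sqrt S (fun k => ‖besselJ (k - 1) (4 * Real.pi * x)‖)
      (fun k => ‖besselJ (2 * k - 1) (4 * Real.pi * y)‖)
    have h2 : Real.sqrt (144 * (K / x)) * Real.sqrt (144 * (K / y)) = 144 * K / Real.sqrt (x * y) := by
      rw [← Real.sqrt_mul (by positivity), show 144 * (K / x) * (144 * (K / y)) = (144 * K) ^ 2 / (x * y) by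
        field_simp, Real.sqrt_div (by positivity), Real.sqrt_sq (by positivity)]
    calc _ ≤ M * (Real.sqrt (144 * (K / x)) * Real.sqrt (144 * (K / y))) := by
          apply mul_le_mul_of_nonneg_left _ hM0
          exact hcs.trans (mul_le_mul (Real.sqrt_le_sqrt hA) (Real.sqrt_le_sqrt hB) (Real.sqrt_nonneg _) (Real.sqrt_nonneg _))
      _ = _ := by rw [h2]; ring
  · intro k hk
    split_ifs with hk2
    · have : h ((k : ℝ) / K) = 0 := by
        by_contra hne
        have := (hsupp (Function.mem_support.2 hne)).2
        rw [div_lt_iff₀ hK0] at this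
        apply hk
        rw [hSdef, Finset.mem_filter, Finset.mem_range]
        exact ⟨Nat.lt_ceil.2 this, by omega⟩
      rw [this]; simp
    · rfl
end

section
/- Fix ε ∈ (0, 1/10) and a sequence of constants (C_B)_{B ≥ 0}. There is a constant C, depending only on ε and the C_B, such that the following holds. Let K ≥ 2 be real and let h be a smooth non-negative function on ℝ supported on the interval (1,2) satisfying |h^{(B)}(u)| ≤ C_B K^{εB} for every integer B ≥ 0 and every u ∈ ℝ. Then for all reals x, y with x > K^{2−ε} and 0 < y < K^{2+ε}, one has |∑_{k ≥ 2 even} i^k h(k/K) J_{k−1}(x) J_{2k−1}(y)| ≤ C K^{−5/6}. -/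
open MeasureTheory

noncomputable def RJ (n : ℤ) (x : ℝ) : ℝ :=
  ∫ t in (-(1:ℝ)/2)..(1/2), Real.cos (2 * Real.pi * n * t - x * Real.sin (2 * Real.pi * t))

lemma besselJ_eq (l : ℕ) (x : ℝ) : besselJ l x = (RJ l x : ℂ) := by
  unfold besselJ RJ
  have h1 : ∀ t : ℝ, ee (l * t) * Complex.exp (-Complex.I * x * Real.sin (2 * Real.pi * t))
      = ((Real.cos (2 * Real.pi * (l:ℤ) * t - x * Real.sin (2 * Real.pi * t)) : ℝ) : ℂ)
       + Complex.I * ((Real.sin (2 * Real.pi * (l:ℤ) * t - x * Real.sin (2 * Real.pi * t)) : ℝ) : ℂ) := by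
    intro t
    unfold ee
    rw [← Complex.exp_add, Complex.ofReal_cos (_ - _), Complex.ofReal_sin (_ - _), mul_comm Complex.I,
      ← Complex.exp_mul_I]
    congr 1
    push_cast
    ring
  simp_rw [h1]
  rw [intervalIntegral.integral_add]
  · rw [intervalIntegral.integral_const_mul, intervalIntegral.integral_ofReal,
      intervalIntegral.integral_ofReal]
    have : ∫ t in (-(1:ℝ)/2)..(1/2), Real.sin (2 * Real.pi * (l:ℤ) * t - x * Real.sin (2 * Real.pi * t)) = 0 := by
      have h2 := intervalIntegral.integral_comp_neg (a := -(1:ℝ)/2) (b := 1/2)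
        (fun t => Real.sin (2 * Real.pi * (l:ℤ) * t - x * Real.sin (2 * Real.pi * t)))
      have h3 : ∀ t : ℝ, Real.sin (2 * Real.pi * (l:ℤ) * (-t) - x * Real.sin (2 * Real.pi * (-t)))
        = - Real.sin (2 * Real.pi * (l:ℤ) * t - x * Real.sin (2 * Real.pi * t)) := by
        intro t
        rw [← Real.sin_neg]
        congr 1
        rw [mul_neg, mul_neg, Real.sin_neg]; ring
      simp_rw [h3] at h2
      rw [intervalIntegral.integral_neg] at h2
      have e1 : -(-(1:ℝ)/2) = 1/2 := by norm_num
      have e2 : -((1:ℝ)/2) = -1/2 := by norm_num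
      rw [e1, e2] at h2
      linarith
    rw [this]; simp
  · apply Continuous.intervalIntegrable; fun_prop
  · apply Continuous.intervalIntegrable; fun_prop

lemma RJ_abs_le (n : ℤ) (x : ℝ) : |RJ n x| ≤ 1 := by
  have := intervalIntegral.norm_integral_le_of_norm_le_const (a := -(1:ℝ)/2) (b := 1/2) (C := 1)
    (f := fun t => Real.cos (2 * Real.pi * n * t - x * Real.sin (2 * Real.pi * t)))
    (fun t _ => Real.abs_cos_le_one _)
  rw [Real.norm_eq_abs] at this
  refine this.trans ?_
  norm_num

lemma RJ_rec (n : ℤ) (x : ℝ) : x * (RJ (n+1) x + RJ (n-1) x) = 2 * n * RJ n x := by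
  have hd : ∀ t ∈ Set.uIcc (-(1:ℝ)/2) (1/2), HasDerivAt
      (fun t : ℝ => Real.sin (2 * Real.pi * n * t - x * Real.sin (2 * Real.pi * t)))
      (Real.cos (2 * Real.pi * n * t - x * Real.sin (2 * Real.pi * t)) *
        (2 * Real.pi * n * 1 - x * (Real.cos (2 * Real.pi * t) * (2 * Real.pi * 1)))) t := by
    intro t _
    exact (((hasDerivAt_id t).const_mul _).sub
      ((((hasDerivAt_id t).const_mul (2 * Real.pi)).sin).const_mul x)).sin
  have hi := intervalIntegral.integral_eq_sub_of_hasDerivAt hd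
    (by apply Continuous.intervalIntegrable; fun_prop)
  have hb : Real.sin (2 * Real.pi * n * (1/2) - x * Real.sin (2 * Real.pi * (1/2)))
     - Real.sin (2 * Real.pi * n * (-1/2) - x * Real.sin (2 * Real.pi * (-1/2))) = 0 := by
    have e1 : 2 * Real.pi * (1/2) = Real.pi := by ring
    have e2 : 2 * Real.pi * (-1/2) = -Real.pi := by ring
    have e3 : 2 * Real.pi * n * (1/2) = n * Real.pi := by ring
    have e4 : 2 * Real.pi * n * (-1/2) = -(n * Real.pi) := by ring
    rw [e1, e2, e3, e4, Real.sin_neg, Real.sin_pi]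
    simp [Real.sin_int_mul_pi]
  rw [hb] at hi
  have hc : ∀ t : ℝ, Real.cos (2 * Real.pi * n * t - x * Real.sin (2 * Real.pi * t)) *
        (2 * Real.pi * n * 1 - x * (Real.cos (2 * Real.pi * t) * (2 * Real.pi * 1)))
      = 2 * Real.pi * n * Real.cos (2 * Real.pi * n * t - x * Real.sin (2 * Real.pi * t))
        - Real.pi * x * (Real.cos (2 * Real.pi * (n+1:ℤ) * t - x * Real.sin (2 * Real.pi * t))
          + Real.cos (2 * Real.pi * (n-1:ℤ) * t - x * Real.sin (2 * Real.pi * t))) := by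
    intro t
    have e1 : 2 * Real.pi * (n+1:ℤ) * t - x * Real.sin (2 * Real.pi * t) =
      (2 * Real.pi * n * t - x * Real.sin (2 * Real.pi * t)) + 2 * Real.pi * t := by push_cast; ring
    have e2 : 2 * Real.pi * (n-1:ℤ) * t - x * Real.sin (2 * Real.pi * t) =
      (2 * Real.pi * n * t - x * Real.sin (2 * Real.pi * t)) - 2 * Real.pi * t := by push_cast; ring
    rw [e1, e2, Real.cos_add, Real.cos_sub _ (2 * Real.pi * t)]
    ring
  simp_rw [hc] at hi
  rw [intervalIntegral.integral_sub, intervalIntegral.integral_const_mul,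
    intervalIntegral.integral_const_mul, intervalIntegral.integral_add] at hi
  · change 2 * Real.pi * n * RJ n x - Real.pi * x * (RJ (n+1) x + RJ (n-1) x) = 0 at hi
    have : Real.pi * (x * (RJ (n+1) x + RJ (n-1) x)) = Real.pi * (2 * n * RJ n x) := by linarith
    exact mul_left_cancel₀ Real.pi_ne_zero this
  all_goals apply Continuous.intervalIntegrable; fun_prop

lemma RJ_deriv (n : ℤ) (x : ℝ) : HasDerivAt (RJ n) ((RJ (n-1) x - RJ (n+1) x)/2) x := by
  have := (intervalIntegral.hasDerivAt_integral_of_dominated_loc_of_deriv_le (μ := volume)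
    (a := -(1:ℝ)/2) (b := 1/2) (x₀ := x) (s := Set.univ)
    (F := fun x t => Real.cos (2 * Real.pi * n * t - x * Real.sin (2 * Real.pi * t)))
    (F' := fun x t => - Real.sin (2 * Real.pi * n * t - x * Real.sin (2 * Real.pi * t)) *
        (0 - 1 * Real.sin (2 * Real.pi * t)))
    (bound := fun _ => 1) Filter.univ_mem ?_ ?_ ?_ ?_ ?_ ?_).2
  · refine HasDerivAt.congr_deriv (f := RJ n) this ?_
    have hc : ∀ t : ℝ, - Real.sin (2 * Real.pi * n * t - x * Real.sin (2 * Real.pi * t)) *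
        (0 - 1 * Real.sin (2 * Real.pi * t)) =
        (1/2) * (Real.cos (2 * Real.pi * (n-1:ℤ) * t - x * Real.sin (2 * Real.pi * t))
          - Real.cos (2 * Real.pi * (n+1:ℤ) * t - x * Real.sin (2 * Real.pi * t))) := by
      intro t
      have e1 : 2 * Real.pi * (n+1:ℤ) * t - x * Real.sin (2 * Real.pi * t) =
        (2 * Real.pi * n * t - x * Real.sin (2 * Real.pi * t)) + 2 * Real.pi * t := by push_cast; ring
      have e2 : 2 * Real.pi * (n-1:ℤ) * t - x * Real.sin (2 * Real.pi * t) =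
        (2 * Real.pi * n * t - x * Real.sin (2 * Real.pi * t)) - 2 * Real.pi * t := by push_cast; ring
      rw [e1, e2, Real.cos_add, Real.cos_sub _ (2 * Real.pi * t)]
      ring
    rw [intervalIntegral.integral_congr (fun t _ => hc t)]
    rw [intervalIntegral.integral_const_mul, intervalIntegral.integral_sub]
    · unfold RJ; ring
    all_goals apply Continuous.intervalIntegrable; fun_prop
  · filter_upwards with y
    apply Continuous.aestronglyMeasurable; fun_prop
  · apply Continuous.intervalIntegrable; fun_prop
  · apply Continuous.aestronglyMeasurable; fun_prop
  · filter_upwards with t _ y _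
    rw [norm_mul, norm_neg, zero_sub, norm_neg, one_mul]
    exact mul_le_one₀ (Real.abs_sin_le_one _) (norm_nonneg _) (Real.abs_sin_le_one _)
  · exact intervalIntegrable_const
  · filter_upwards with t _ y _
    exact (((hasDerivAt_id y).mul_const _).const_sub _).cos.congr_deriv (by simp)

lemma RJ0_deriv (y : ℝ) (hy : 0 < y) : HasDerivAt (RJ 0) (- RJ 1 y) y := by
  have h1 := RJ_deriv 0 y
  have h2 := RJ_rec 0 y
  have e1 : (0:ℤ) + 1 = 1 := by norm_num
  have e2 : (0:ℤ) - 1 = -1 := by norm_num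
  rw [e1, e2] at h1 h2
  have h3 : RJ 1 y + RJ (-1) y = 0 := by
    have : y * (RJ 1 y + RJ (-1) y) = 0 := by rw [h2]; simp
    exact (mul_eq_zero.1 this).resolve_left hy.ne'
  refine h1.congr_deriv ?_
  linarith

lemma RJ1_deriv (y : ℝ) (hy : 0 < y) : HasDerivAt (RJ 1) (RJ 0 y - RJ 1 y / y) y := by
  have h1 := RJ_deriv 1 y
  have h2 := RJ_rec 1 y
  have e1 : (1:ℤ) + 1 = 2 := by norm_num
  have e2 : (1:ℤ) - 1 = 0 := by norm_num
  rw [e1, e2] at h1 h2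
  refine h1.congr_deriv ?_
  have : RJ 2 y = 2 * (RJ 1 y / y) - RJ 0 y := by
    field_simp
    push_cast at h2
    linarith
  rw [this]; ring

lemma RJ01 (x : ℝ) (hx : 1 ≤ x) : RJ 0 x ^ 2 + RJ 1 x ^ 2 ≤ 18 / x := by
  have hu := RJ0_deriv
  have hv := RJ1_deriv
  set u := RJ 0
  set v := RJ 1
  let F : ℝ → ℝ := fun y => (y * (u y ^2 + v y ^2) - u y * v y) * Real.exp (1/y)
  have hF : ∀ y, 0 < y → HasDerivAt F
     ((u y * v y / y - (y * (u y ^2 + v y ^2) - u y * v y) / y^2) * Real.exp (1/y)) y := by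
    intro y hy
    have h1 := (((hasDerivAt_id y).mul (((hu y hy).pow 2).add ((hv y hy).pow 2))).sub
      ((hu y hy).mul (hv y hy))).mul ((hasDerivAt_inv hy.ne').exp)
    have h2 : F = ((id * (u ^ 2 + v ^ 2)) - u * v) * (fun y => Real.exp (y⁻¹)) := by
      funext z; simp [F]
    rw [h2]
    refine h1.congr_deriv ?_
    simp
    field_simp
    ring
  have hanti : AntitoneOn F (Set.Ici 1) := by
    apply antitoneOn_of_deriv_nonpos (convex_Ici 1)
    · intro y hy
      exact (hF y (lt_of_lt_of_le one_pos hy)).continuousAt.continuousWithinAt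
    · intro y hy
      rw [interior_Ici] at hy
      exact (hF y (lt_trans one_pos hy)).differentiableAt.differentiableWithinAt
    · intro y hy
      rw [interior_Ici] at hy
      have hy1 : 1 < y := hy
      have hy0 : 0 < y := by linarith
      rw [(hF y hy0).deriv]
      refine mul_nonpos_of_nonpos_of_nonneg ?_ (Real.exp_pos _).le
      have : u y * v y / y - (y * (u y ^2 + v y ^2) - u y * v y) / y^2
        = - (y * (u y ^2 + v y ^2) - u y * v y - y * (u y * v y)) / y^2 := by
        field_simp; ring
      rw [this]
      apply div_nonpos_of_nonpos_of_nonneg _ (by positivity)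
      nlinarith [sq_nonneg (u y - v y), sq_nonneg (u y + v y), mul_nonneg (sub_nonneg.2 hy1.le) (sq_nonneg (u y - v y)), sq_nonneg (u y), sq_nonneg (v y), mul_nonneg (sub_nonneg.2 hy1.le) (sq_nonneg (u y)), mul_nonneg (sub_nonneg.2 hy1.le) (sq_nonneg (v y))]
  have h1 := hanti (Set.mem_Ici.2 le_rfl) (Set.mem_Ici.2 hx) hx
  have hx0 : 0 < x := by linarith
  have h2 : F 1 ≤ 9 := by
    have a1 := abs_le.1 (RJ_abs_le 0 1)
    have a2 := abs_le.1 (RJ_abs_le 1 1)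
    have e1 : Real.exp (1/1) ≤ 3 := by
      rw [div_one]; linarith [Real.exp_one_lt_d9]
    have b : (1 * (u 1 ^2 + v 1 ^2) - u 1 * v 1) ≤ 3 := by
      change (1 * (RJ 0 1 ^2 + RJ 1 1 ^2) - RJ 0 1 * RJ 1 1) ≤ 3
      nlinarith
    calc F 1 ≤ 3 * Real.exp (1/1) := mul_le_mul_of_nonneg_right b (Real.exp_pos _).le
      _ ≤ 9 := by linarith
  have hpos : (x / 2) * (u x ^2 + v x ^2) ≤ x * (u x ^2 + v x ^2) - u x * v x := by
    nlinarith [sq_nonneg (u x - v x), sq_nonneg (u x + v x), mul_nonneg (sub_nonneg.2 hx) (sq_nonneg (u x)), mul_nonneg (sub_nonneg.2 hx) (sq_nonneg (v x))]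
  have h3 : x * (u x ^2 + v x ^2) - u x * v x ≤ F x := by
    have : 1 ≤ Real.exp (1/x) := Real.one_le_exp (by positivity)
    have hn : 0 ≤ x * (u x ^2 + v x ^2) - u x * v x := le_trans (by positivity) hpos
    exact le_mul_of_one_le_right hn this
  rw [le_div_iff₀ hx0]
  change F x ≤ F 1 at h1
  nlinarith

lemma RJ_bound (x : ℝ) (hx : 4 ≤ x) (l : ℕ) (hl : 2 * (l:ℝ) + 2 ≤ x) :
    |RJ l x| ≤ 26 / Real.sqrt x := by
  have hx0 : 0 < x := by linarith
  set Q : ℕ → ℝ := fun l => RJ (l+1:ℕ) x ^ 2 + RJ l x ^ 2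
    - 2 * (l+1) / x * (RJ (l+1:ℕ) x * RJ l x) with hQ
  have hlow : ∀ l : ℕ, 2 * (l:ℝ) + 2 ≤ x → (RJ (l+1:ℕ) x ^ 2 + RJ l x ^ 2)/2 ≤ Q l := by
    intro l hl
    have hc : 2 * ((l:ℝ)+1) / x ≤ 1 := by rw [div_le_one hx0]; linarith
    have hc0 : 0 ≤ 2 * ((l:ℝ)+1) / x := by positivity
    simp only [hQ]
    set c := 2 * ((l:ℝ)+1) / x
    nlinarith [sq_nonneg (RJ (l+1:ℕ) x - RJ l x), mul_nonneg hc0 (sq_nonneg (RJ (l+1:ℕ) x - RJ l x)),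
      mul_nonneg (sub_nonneg.2 hc) (sq_nonneg (RJ (l+1:ℕ) x)), mul_nonneg (sub_nonneg.2 hc) (sq_nonneg (RJ l x))]
  have hstep : ∀ l : ℕ, Q (l+1) = Q l - 2 / x * (RJ (l+1+1:ℕ) x * RJ (l+1:ℕ) x) := by
    intro l
    have h := RJ_rec (l+1:ℕ) x
    have e1 : (((l+1:ℕ):ℤ)+1) = ((l+1+1:ℕ):ℤ) := by push_cast; ring
    have e2 : (((l+1:ℕ):ℤ)-1) = ((l:ℕ):ℤ) := by push_cast; ring
    rw [e1, e2] at h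
    have h' : RJ (l+1+1:ℕ) x = 2 * (l+1) / x * RJ (l+1:ℕ) x - RJ l x := by
      field_simp
      push_cast at h ⊢
      linarith
    simp only [hQ]
    rw [h']
    push_cast
    field_simp
    ring
  have hgrow : ∀ l : ℕ, 2 * (l:ℝ) + 2 ≤ x → Q l ≤ Real.exp (4 * l / x) * Q 0 := by
    intro l
    induction l with
    | zero => intro _; simp
    | succ l ih =>
      intro h
      push_cast at h
      have ih := ih (by linarith)
      have h1 := hlow (l+1) (by push_cast; linarith)
      have h2 := hstep l
      have h3 : -(RJ (l+1+1:ℕ) x * RJ (l+1:ℕ) x) ≤ Q (l+1) := by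
        nlinarith [sq_nonneg (RJ (l+1+1:ℕ) x + RJ (l+1:ℕ) x)]
      have hq : 0 ≤ Q (l+1) := le_trans (by positivity) h1
      have h5 : 2 / x ≤ 1/2 := by rw [div_le_iff₀ hx0]; linarith
      have h50 : 0 < 2/x := by positivity
      have h6 : Q (l+1) * (1 - 2/x) ≤ Q l := by nlinarith
      have h7 : Q (l+1) ≤ Q l * (1 + 4 / x) := by
        have e : 4 / x = 2 * (2/x) := by ring
        rw [e]
        set d := 2/x
        have : Q (l+1) ≤ Q (l+1) * ((1-d) * (1+2*d)) :=
          le_mul_of_one_le_right hq (by nlinarith)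
        nlinarith
      have hq0 : 0 ≤ Q l := by nlinarith
      have h8 : 1 + 4/x ≤ Real.exp (4/x) := by linarith [Real.add_one_le_exp (4/x)]
      calc Q (l+1) ≤ Q l * (1+4/x) := h7
        _ ≤ (Real.exp (4 * l / x) * Q 0) * Real.exp (4/x) :=
          mul_le_mul ih h8 (by positivity) (hq0.trans ih)
        _ = Real.exp (4 * (l+1:ℕ) / x) * Q 0 := by
          rw [mul_right_comm, ← Real.exp_add]; congr 2; push_cast; ring
  have hQ0 : Q 0 ≤ 36 / x := by
    have h1 := RJ01 x (by linarith)
    have hc : 2 * (((0:ℕ):ℝ)+1) / x ≤ 1 := by rw [div_le_one hx0]; push_cast; linarith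
    have hc0 : 0 ≤ 2 * (((0:ℕ):ℝ)+1) / x := by positivity
    have e : 36/x = 2 * (18/x) := by ring
    rw [e]
    simp only [hQ]
    set c := 2 * (((0:ℕ):ℝ)+1) / x
    change RJ 1 x ^ 2 + RJ 0 x ^ 2 - c * (RJ 1 x * RJ 0 x) ≤ _
    nlinarith [sq_nonneg (RJ 1 x + RJ 0 x), mul_nonneg hc0 (sq_nonneg (RJ 1 x + RJ 0 x)), sq_nonneg (RJ 1 x), sq_nonneg (RJ 0 x)]
  have h1 := hlow l hl
  have h2 := hgrow l hl
  have h3 : Real.exp (4 * l / x) ≤ 9 := by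
    have : 4 * (l:ℝ) / x ≤ 1 + 1 := by rw [div_le_iff₀ hx0]; linarith
    calc _ ≤ Real.exp (1+1) := Real.exp_le_exp.2 this
      _ = Real.exp 1 * Real.exp 1 := Real.exp_add _ _
      _ ≤ 3 * 3 := by
        have : Real.exp 1 ≤ 3 := by linarith [Real.exp_one_lt_d9]
        exact mul_le_mul this this (Real.exp_pos _).le (by norm_num)
      _ = 9 := by norm_num
  have hq : 0 ≤ Q 0 := le_trans (by positivity) (hlow 0 (by push_cast; linarith))
  have h4 : RJ l x ^ 2 ≤ 648 / x := by
    have e : 648 / x = 2 * (9 * (36/x)) := by ring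
    have : Real.exp (4 * l / x) * Q 0 ≤ 9 * (36/x) := mul_le_mul h3 hQ0 hq (by norm_num)
    rw [e]
    nlinarith [sq_nonneg (RJ (l+1:ℕ) x)]
  apply abs_le_of_sq_le_sq _ (by positivity)
  rw [div_pow, Real.sq_sqrt hx0.le]
  refine h4.trans ?_
  gcongr
  norm_num

lemma int_bound (f : ℝ → ℝ) (hf : Continuous f) (A B : ℝ) (hB : 0 ≤ B) (h0 : ∀ s, 0 ≤ f s)
    (hA : ∀ s, f s ≤ A) (h1 : ∀ s, 0 < s → s ≤ 1/2 → f s * s ≤ B) :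
    ∫ s in (0:ℝ)..(1/2), f s ≤ 60 * (A ^ ((1:ℝ)/60) * B ^ ((59:ℝ)/60)) := by
  have hA0 : 0 ≤ A := (h0 0).trans (hA 0)
  have hle : ∫ s in (0:ℝ)..(1/2), f s ≤ ∫ s in (0:ℝ)..(1/2),
      (A ^ ((1:ℝ)/60) * B ^ ((59:ℝ)/60)) * s ^ (-(59:ℝ)/60) := by
    apply intervalIntegral.integral_mono_on_of_le_Ioo (by norm_num) (hf.intervalIntegrable _ _)
    · exact (intervalIntegral.intervalIntegrable_rpow' (by norm_num)).const_mul _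
    · intro s hs
      have hs0 : 0 < s := hs.1
      have hb : f s ≤ B / s := by
        rw [le_div_iff₀ hs0]; exact h1 s hs.1 hs.2.le
      calc f s = f s ^ ((1:ℝ)/60 + 59/60) := by norm_num
        _ = f s ^ ((1:ℝ)/60) * f s ^ ((59:ℝ)/60) := Real.rpow_add_of_nonneg (h0 s) (by norm_num) (by norm_num)
        _ ≤ A ^ ((1:ℝ)/60) * (B/s) ^ ((59:ℝ)/60) := by
          apply mul_le_mul
          · exact Real.rpow_le_rpow (h0 s) (hA s) (by norm_num)
          · exact Real.rpow_le_rpow (h0 s) hb (by norm_num)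
          · exact Real.rpow_nonneg (h0 s) _
          · exact Real.rpow_nonneg hA0 _
        _ = _ := by
          rw [Real.div_rpow hB hs0.le, neg_div, Real.rpow_neg hs0.le]; ring
  refine hle.trans ?_
  rw [intervalIntegral.integral_const_mul, integral_rpow (Or.inl (by norm_num)), mul_comm]
  apply mul_le_mul_of_nonneg_right _ (by positivity)
  have e : (-(59:ℝ)/60) + 1 = 1/60 := by norm_num
  rw [e, Real.zero_rpow (by norm_num)]
  have : ((1:ℝ)/2) ^ ((1:ℝ)/60) ≤ 1 := Real.rpow_le_one (by norm_num) (by norm_num) (by norm_num)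
  linarith

lemma ee_norm (s : ℝ) : ‖ee s‖ = 1 := by
  unfold ee
  rw [show (2 * Real.pi * Complex.I * s : ℂ) = ((2 * Real.pi * s : ℝ) : ℂ) * Complex.I by push_cast; ring]
  exact Complex.norm_exp_ofReal_mul_I _

lemma ee_cont : Continuous ee := by unfold ee; fun_prop

lemma ee_add (s t : ℝ) : ee (s + t) = ee s * ee t := by
  unfold ee; rw [← Complex.exp_add]; congr 1; push_cast; ring

lemma ee_one : ee 1 = 1 := by
  unfold ee
  rw [Complex.ofReal_one, mul_one]; exact Complex.exp_two_pi_mul_I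

lemma ee_nat (n : ℕ) (t : ℝ) : ee (n * t) = ee t ^ n := by
  unfold ee; rw [← Complex.exp_nat_mul]; congr 1; push_cast; ring

lemma ee_sub_one (s : ℝ) (h0 : |s| ≤ 1/2) : 4 * |s| ≤ ‖1 - ee s‖ := by
  rw [norm_sub_rev]
  unfold ee
  rw [show (2 * Real.pi * Complex.I * s : ℂ) = Complex.I * ((2 * Real.pi * s : ℝ) : ℂ) by push_cast; ring,
    Complex.norm_exp_I_mul_ofReal_sub_one, show 2 * Real.pi * s / 2 = Real.pi * s by ring, norm_mul]
  have h : 2 * |s| ≤ |Real.sin (Real.pi * s)| := by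
    have hp : |Real.pi * s| ≤ Real.pi / 2 := by
      rw [abs_mul, abs_of_pos Real.pi_pos]; nlinarith [Real.pi_pos]
    have := Real.mul_abs_le_abs_sin hp
    rw [abs_mul, abs_of_pos Real.pi_pos] at this
    have e : 2 / Real.pi * (Real.pi * |s|) = 2 * |s| := by field_simp
    linarith
  simp only [Real.norm_eq_abs, abs_two]
  linarith

lemma abel_id (a : ℕ → ℂ) (z : ℂ) (n : ℕ) :
    (1 - z) * ∑ m ∈ Finset.range n, a m * z ^ m
      = a 0 - a n * z ^ n + ∑ m ∈ Finset.range n, (a (m+1) - a m) * z ^ (m+1) := by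
  induction n with
  | zero => simp
  | succ n ih => rw [Finset.sum_range_succ, Finset.sum_range_succ, mul_add, ih]; ring

lemma int_poly (a : ℕ → ℂ) (n : ℕ) (ha0 : a 0 = 0) (han : a n = 0) (A B : ℝ)
    (hA : ∑ m ∈ Finset.range n, ‖a m‖ ≤ A) (hB : ∑ m ∈ Finset.range n, ‖a (m+1) - a m‖ ≤ B) :
    ∫ t in (-(1:ℝ)/2)..(1/2), ‖∑ m ∈ Finset.range n, a m * ee (4 * t) ^ m‖
      ≤ 120 * (A ^ ((1:ℝ)/60) * B ^ ((59:ℝ)/60)) := by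
  set f : ℝ → ℝ := fun s => ‖∑ m ∈ Finset.range n, a m * ee s ^ m‖ with hf
  have hfc : Continuous f := by have := ee_cont; fun_prop
  have hB0 : 0 ≤ B := le_trans (Finset.sum_nonneg fun _ _ => norm_nonneg _) hB
  have hfA : ∀ s, f s ≤ A := by
    intro s
    refine (norm_sum_le _ _).trans (le_trans (le_of_eq ?_) hA)
    apply Finset.sum_congr rfl
    intro m _
    rw [norm_mul, norm_pow, ee_norm, one_pow, mul_one]
  have hfB : ∀ s, |s| ≤ 1/2 → f s * |s| ≤ B := by
    intro s hs
    have h1 := ee_sub_one s hs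
    have h2 : ‖1 - ee s‖ * f s ≤ B := by
      rw [hf, ← norm_mul, abel_id, ha0, han]
      simp only [zero_mul, sub_zero, zero_add]
      refine (norm_sum_le _ _).trans (le_trans (le_of_eq ?_) hB)
      apply Finset.sum_congr rfl
      intro m _
      rw [norm_mul, norm_pow, ee_norm, one_pow, mul_one]
    have h3 : 0 ≤ f s := norm_nonneg _
    nlinarith [abs_nonneg s, mul_nonneg h3 (abs_nonneg s), mul_le_mul_of_nonneg_right h1 h3]
  have hper : Function.Periodic f 1 := by
    intro s; simp only [hf]; rw [ee_add, ee_one, mul_one]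
  have hii : ∀ p q : ℝ, IntervalIntegrable f volume p q := fun p q => hfc.intervalIntegrable _ _
  have hint : ∫ t in (-(1:ℝ)/2)..(1/2), f (4 * t) = ∫ s in (-(1:ℝ)/2)..(1/2), f s := by
    rw [intervalIntegral.integral_comp_mul_left f (by norm_num : (4:ℝ) ≠ 0)]
    have e : ∀ c : ℝ, ∫ s in c..(c+1), f s = ∫ s in (-(1:ℝ)/2)..(1/2), f s := by
      intro c
      rw [hper.intervalIntegral_add_eq c (-(1:ℝ)/2)]; norm_num
    have e1 := e (-2)
    have e2 := e (-1)
    have e3 := e 0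
    have e4 := e 1
    have i1 := intervalIntegral.integral_add_adjacent_intervals (hii (-2) (-1)) (hii (-1) 0)
    have i2 := intervalIntegral.integral_add_adjacent_intervals (hii (-2) 0) (hii 0 1)
    have i3 := intervalIntegral.integral_add_adjacent_intervals (hii (-2) 1) (hii 1 2)
    norm_num at e1 e2 e3 e4 ⊢
    linarith
  change ∫ t in (-(1:ℝ)/2)..(1/2), f (4 * t) ≤ _
  rw [hint, ← intervalIntegral.integral_add_adjacent_intervals (hii (-(1:ℝ)/2) 0) (hii 0 (1/2))]
  have hneg : ∫ s in (-(1:ℝ)/2)..0, f s = ∫ s in (0:ℝ)..(1/2), f (-s) := by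
    rw [intervalIntegral.integral_comp_neg]; norm_num
  rw [hneg]
  have b1 := int_bound f hfc A B hB0 (fun _ => norm_nonneg _) hfA (by
    intro s h0 h1
    have := hfB s (by rwa [abs_of_pos h0])
    rwa [abs_of_pos h0] at this)
  have b2 := int_bound (fun s => f (-s)) (hfc.comp continuous_neg) A B hB0 (fun _ => norm_nonneg _)
    (fun s => hfA _) (by
    intro s h0 h1
    have := hfB (-s) (by rwa [abs_neg, abs_of_pos h0])
    rwa [abs_neg, abs_of_pos h0] at this)
  linarith

lemma sum_bessel (a : ℕ → ℂ) (n : ℕ) (ha0 : a 0 = 0) (han : a n = 0) (A B : ℝ) (y : ℝ)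
    (hA : ∑ m ∈ Finset.range n, ‖a m‖ ≤ A) (hB : ∑ m ∈ Finset.range n, ‖a (m+1) - a m‖ ≤ B) :
    ‖∑ m ∈ Finset.range n, a m * besselJ (2 * (2 * m) - 1) y‖
      ≤ 120 * (A ^ ((1:ℝ)/60) * B ^ ((59:ℝ)/60)) := by
  refine le_trans ?_ (int_poly a n ha0 han A B hA hB)
  have hec := ee_cont
  have e : ∑ m ∈ Finset.range n, a m * besselJ (2 * (2 * m) - 1) y
    = ∫ t in (-(1:ℝ)/2)..(1/2), ∑ m ∈ Finset.range n, a m *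
      (ee ((2 * (2 * m) - 1 : ℕ) * t) * Complex.exp (-Complex.I * y * Real.sin (2 * Real.pi * t))) := by
    rw [intervalIntegral.integral_finsetSum]
    · apply Finset.sum_congr rfl
      intro m _
      rw [intervalIntegral.integral_const_mul]; rfl
    · intro m _
      apply Continuous.intervalIntegrable; fun_prop
  rw [e]
  refine (intervalIntegral.norm_integral_le_integral_norm (by norm_num)).trans (le_of_eq ?_)
  apply intervalIntegral.integral_congr
  intro t _
  have e2 : ∑ m ∈ Finset.range n, a m *
      (ee ((2 * (2 * m) - 1 : ℕ) * t) * Complex.exp (-Complex.I * y * Real.sin (2 * Real.pi * t)))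
      = (∑ m ∈ Finset.range n, a m * ee (4 * t) ^ m) *
        (ee (-t) * Complex.exp (-Complex.I * y * Real.sin (2 * Real.pi * t))) := by
    rw [Finset.sum_mul]
    apply Finset.sum_congr rfl
    intro m _
    rcases Nat.eq_zero_or_pos m with rfl | hm
    · rw [ha0]; simp
    · rw [← ee_nat]
      have : ((2 * (2 * m) - 1 : ℕ) : ℝ) * t = m * (4 * t) + -t := by
        rw [Nat.cast_sub (by omega)]; push_cast; ring
      rw [this, ee_add]; ring
  have e3 : ‖Complex.exp (-Complex.I * y * Real.sin (2 * Real.pi * t))‖ = 1 := by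
    rw [show (-Complex.I * y * Real.sin (2 * Real.pi * t) : ℂ) =
      ((-(y * Real.sin (2 * Real.pi * t)) : ℝ) : ℂ) * Complex.I by push_cast; ring]
    exact Complex.norm_exp_ofReal_mul_I _
  simp only []
  rw [e2, norm_mul, norm_mul, e3, ee_norm, mul_one, mul_one]

lemma bessel_norm_le (l : ℕ) (x : ℝ) : ‖besselJ l x‖ ≤ 1 := by
  rw [besselJ_eq, Complex.norm_real]; exact RJ_abs_le _ _

lemma diff_bound (x : ℝ) (hx : 0 < x) (m : ℕ) (hm : 1 ≤ m) (p q M : ℝ)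
    (h1 : |RJ (2 * m - 1 : ℕ) x| ≤ M) (h2 : |RJ (2 * m : ℕ) x| ≤ M) :
    ‖Complex.I ^ (2 * (m+1)) * (q : ℂ) * besselJ (2 * (m+1) - 1) x
      - Complex.I ^ (2 * m) * (p : ℂ) * besselJ (2 * m - 1) x‖
      ≤ |q| * (4 * m / x * M) + |q - p| * M := by
  rw [besselJ_eq, besselJ_eq, pow_mul, pow_mul, Complex.I_sq, pow_succ]
  have hr := RJ_rec (2 * m : ℕ) x
  have e1 : (((2 * m : ℕ) : ℤ) + 1) = ((2 * (m+1) - 1 : ℕ) : ℤ) := by omega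
  have e2 : (((2 * m : ℕ) : ℤ) - 1) = ((2 * m - 1 : ℕ) : ℤ) := by omega
  rw [e1, e2] at hr
  have hr' : RJ (2 * (m+1) - 1 : ℕ) x + RJ (2 * m - 1 : ℕ) x = 4 * m / x * RJ (2 * m : ℕ) x := by
    field_simp
    push_cast at hr ⊢
    linarith
  set u := RJ (2 * (m+1) - 1 : ℕ) x
  set v := RJ (2 * m - 1 : ℕ) x
  set w := RJ (2 * m : ℕ) x
  have e3 : (-1 : ℂ) ^ m * -1 * q * u - (-1) ^ m * p * v
      = (-1) ^ m * ((-(q * (u + v) - (q - p) * v) : ℝ) : ℂ) := by push_cast; ring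
  rw [e3, norm_mul, norm_pow, norm_neg, norm_one, one_pow, one_mul, Complex.norm_real, norm_neg, hr']
  refine (norm_sub_le _ _).trans ?_
  rw [norm_mul, norm_mul, norm_mul]
  simp only [Real.norm_eq_abs]
  rw [abs_of_nonneg (by positivity : 0 ≤ 4 * (m:ℝ) / x)]
  gcongr

theorem stmt3 (ε : ℝ) (hε : 0 < ε) (hε' : ε < 1/10) (Cb : ℕ → ℝ) :
    ∃ C : ℝ, ∀ K : ℝ, 2 ≤ K → ∀ h : ℝ → ℝ,
      ContDiff ℝ (⊤ : ℕ∞) h → (∀ u, 0 ≤ h u) →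
      Function.support h ⊆ Set.Ioo 1 2 →
      (∀ (B : ℕ) (u : ℝ), |iteratedDeriv B h u| ≤ Cb B * K ^ (ε * B)) →
      ∀ x y : ℝ, K ^ ((2:ℝ) - ε) < x → 0 < y → y < K ^ ((2:ℝ) + ε) →
      ‖∑' k : ℕ, if Even k ∧ 2 ≤ k then
          Complex.I ^ k * (h ((k : ℝ) / K) : ℂ) * besselJ (k - 1) x *
            besselJ (2 * k - 1) y else 0‖
        ≤ C * K ^ (-(5:ℝ)/6) := by
  refine ⟨272 * Cb 0 + 120 * (52 * (4 * Cb 0 + 2 * Cb 1)), ?_⟩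
  intro K hK h hsm hnn hsupp hder x y hx _ _
  have hK0 : 0 < K := by linarith
  have hK1 : 1 ≤ K := by linarith
  have hb0 : ∀ u, |h u| ≤ Cb 0 := by
    intro u; have := hder 0 u; simpa using this
  have hb1 : ∀ u, |deriv h u| ≤ Cb 1 * K ^ ε := by
    intro u; have := hder 1 u; simpa [iteratedDeriv_one] using this
  have hc0 : 0 ≤ Cb 0 := (abs_nonneg _).trans (hb0 0)
  have hc1 : 0 ≤ Cb 1 := by
    have := (abs_nonneg _).trans (hb1 0)
    exact nonneg_of_mul_nonneg_left this (Real.rpow_pos_of_pos hK0 _)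
  have hout : ∀ u, u ∉ Set.Ioo (1:ℝ) 2 → h u = 0 := by
    intro u hu
    by_contra hne
    exact hu (hsupp hne)
  set a : ℕ → ℂ := fun m => Complex.I ^ (2 * m) * (h (((2 * m : ℕ) : ℝ) / K) : ℂ) * besselJ (2 * m - 1) x with ha
  set n := ⌈K⌉₊ with hn
  have hazero : ∀ m, n ≤ m → a m = 0 := by
    intro m hm
    have : K ≤ m := (Nat.le_ceil K).trans (by exact_mod_cast hm)
    have hh : h (((2 * m : ℕ) : ℝ) / K) = 0 := by
      apply hout
      rintro ⟨_, h2⟩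
      rw [div_lt_iff₀ hK0] at h2
      push_cast at h2
      linarith
    simp only [ha, hh]; simp
  have ha0 : a 0 = 0 := by
    have hh : h (((2 * 0 : ℕ) : ℝ) / K) = 0 := by
      apply hout
      rintro ⟨h1, _⟩
      norm_num at h1
    simp only [ha, hh]; simp
  have hsum : (∑' k : ℕ, if Even k ∧ 2 ≤ k then
          Complex.I ^ k * (h ((k : ℝ) / K) : ℂ) * besselJ (k - 1) x *
            besselJ (2 * k - 1) y else 0)
        = ∑ m ∈ Finset.range n, a m * besselJ (2 * (2 * m) - 1) y := by
    have hinj : Function.Injective (fun m : ℕ => 2 * m) := fun p q hpq => by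
      simp only at hpq; omega
    rw [← hinj.tsum_eq]
    · have : ∀ m : ℕ, (if Even (2 * m) ∧ 2 ≤ 2 * m then
          Complex.I ^ (2 * m) * (h (((2 * m : ℕ) : ℝ) / K) : ℂ) * besselJ (2 * m - 1) x *
            besselJ (2 * (2 * m) - 1) y else 0) = a m * besselJ (2 * (2 * m) - 1) y := by
        intro m
        rcases Nat.eq_zero_or_pos m with rfl | hm
        · rw [ha0]; simp
        · rw [if_pos ⟨even_two_mul m, by omega⟩]
      simp_rw [this]
      apply tsum_eq_sum
      intro m hm
      rw [hazero m (by simpa using hm), zero_mul]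
    · intro k hk
      rw [Function.mem_support] at hk
      have : Even k := by
        by_contra hne
        exact hk (if_neg (fun hh => hne hh.1))
      obtain ⟨r, hr⟩ := this
      exact ⟨r, by simp only; omega⟩
  rw [hsum]
  have hnK : (n:ℝ) ≤ K + 1 := (Nat.ceil_lt_add_one hK0.le).le
  have hanorm : ∀ m, ∀ M, ‖besselJ (2 * m - 1) x‖ ≤ M → ‖a m‖ ≤ Cb 0 * M := by
    intro m M hM
    simp only [ha]
    rw [norm_mul, norm_mul, norm_pow, Complex.norm_I, one_pow, one_mul, Complex.norm_real]
    exact mul_le_mul (hb0 _) hM (norm_nonneg _) hc0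
  have hKp : 0 < K ^ (-(5:ℝ)/6) := Real.rpow_pos_of_pos hK0 _
  rcases le_or_gt K 16 with hsmall | hlarge
  · have h1 : ‖∑ m ∈ Finset.range n, a m * besselJ (2 * (2 * m) - 1) y‖ ≤ n * Cb 0 := by
      refine (norm_sum_le_of_le (f := fun m => a m * besselJ (2 * (2 * m) - 1) y)
        (n := fun _ => Cb 0) _ ?_).trans (le_of_eq ?_)
      · intro m _
        rw [norm_mul]
        have := hanorm m 1 (bessel_norm_le _ _)
        calc _ ≤ (Cb 0 * 1) * 1 := mul_le_mul this (bessel_norm_le _ _) (norm_nonneg _) (by linarith)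
          _ = Cb 0 := by ring
      · simp
    have h2 : (1:ℝ)/16 ≤ K ^ (-(5:ℝ)/6) := by
      calc (1:ℝ)/16 ≤ K⁻¹ := by rw [one_div]; exact inv_anti₀ hK0 hsmall
        _ = K ^ (-1:ℝ) := (Real.rpow_neg_one K).symm
        _ ≤ _ := Real.rpow_le_rpow_of_exponent_le hK1 (by norm_num)
    have h3 : (n:ℝ) * Cb 0 ≤ 17 * Cb 0 := mul_le_mul_of_nonneg_right (by linarith) hc0
    have h4 : 0 ≤ 120 * (52 * (4 * Cb 0 + 2 * Cb 1)) * K ^ (-(5:ℝ)/6) := by positivity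
    have h5 : 272 * Cb 0 * (1/16) ≤ 272 * Cb 0 * K ^ (-(5:ℝ)/6) :=
      mul_le_mul_of_nonneg_left h2 (by positivity)
    linarith
  · have hx5 : 5 * K ≤ x := by
      have h1 : (5:ℝ) ≤ K ^ (1 - ε) := by
        calc (5:ℝ) ≤ 16 ^ ((3:ℝ)/4) := by
              rw [show (16:ℝ) = 2 ^ (4:ℝ) by norm_num, ← Real.rpow_mul (by norm_num)]
              norm_num
          _ ≤ K ^ ((3:ℝ)/4) := Real.rpow_le_rpow (by norm_num) hlarge.le (by norm_num)
          _ ≤ _ := Real.rpow_le_rpow_of_exponent_le hK1 (by linarith)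
      have h2 : K ^ ((2:ℝ) - ε) = K ^ (1 - ε) * K := by
        rw [show (2:ℝ) - ε = (1 - ε) + 1 by ring, Real.rpow_add_one hK0.ne']
      rw [h2] at hx
      nlinarith
    have hx0 : 0 < x := by linarith
    set M := 26 * K ^ (-1 + ε/2) with hM
    have hM0 : 0 ≤ M := by positivity
    have hRJ : ∀ l : ℕ, (l:ℝ) < 2 * K → |RJ l x| ≤ M := by
      intro l hl
      refine (RJ_bound x (by linarith) l (by linarith)).trans ?_
      rw [hM, div_eq_mul_inv]
      apply mul_le_mul_of_nonneg_left _ (by norm_num)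
      have h1 : K ^ (1 - ε/2) ≤ Real.sqrt x := by
        apply Real.le_sqrt_of_sq_le
        rw [← Real.rpow_natCast, ← Real.rpow_mul hK0.le]
        refine le_trans (le_of_eq ?_) hx.le
        congr 1; push_cast; ring
      rw [show (-1 + ε/2) = -(1 - ε/2) by ring, Real.rpow_neg hK0.le]
      exact inv_anti₀ (Real.rpow_pos_of_pos hK0 _) h1
    have hmK : ∀ m ∈ Finset.range n, (m:ℝ) < K := by
      intro m hm; exact Nat.lt_ceil.1 (Finset.mem_range.1 hm)
    set D := 52 * (4 * Cb 0 + 2 * Cb 1) with hD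
    have hD0 : 0 ≤ D := by positivity
    have hA : ∑ m ∈ Finset.range n, ‖a m‖ ≤ D * K ^ (ε/2) := by
      have h1 : ∑ m ∈ Finset.range n, ‖a m‖ ≤ ∑ m ∈ Finset.range n, Cb 0 * M := by
        apply Finset.sum_le_sum
        intro m hm
        apply hanorm
        rw [besselJ_eq, Complex.norm_real]
        apply hRJ
        have := hmK m hm
        have h2 : ((2 * m - 1 : ℕ) : ℝ) ≤ ((2 * m : ℕ) : ℝ) := by exact_mod_cast Nat.sub_le _ _
        push_cast at h2 ⊢
        linarith
      refine h1.trans ?_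
      rw [Finset.sum_const, Finset.card_range, nsmul_eq_mul]
      have h2 : (n:ℝ) * (Cb 0 * M) ≤ (2 * K) * (Cb 0 * M) :=
        mul_le_mul_of_nonneg_right (by linarith) (by positivity)
      refine h2.trans ?_
      have e : K ^ (ε/2) = K ^ (-1 + ε/2) * K := by
        rw [← Real.rpow_add_one hK0.ne']; congr 1; ring
      rw [e, hM, hD]
      have : 0 ≤ K ^ (-1 + ε/2) * K := by positivity
      nlinarith [mul_nonneg hc0 this, mul_nonneg hc1 this]
    have hB : ∑ m ∈ Finset.range n, ‖a (m+1) - a m‖ ≤ D * K ^ (-1 + 3*ε/2) := by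
      have hterm : ∀ m ∈ Finset.range n, ‖a (m+1) - a m‖ ≤ (4 * Cb 0 + 2 * Cb 1) * K ^ (-1 + ε) * M := by
        intro m hm
        have hmk := hmK m hm
        rcases Nat.eq_zero_or_pos m with rfl | hm1
        · have hh : h (((2 * (0+1) : ℕ) : ℝ) / K) = 0 := by
            apply hout
            rintro ⟨h1, _⟩
            rw [lt_div_iff₀ hK0] at h1
            norm_num at h1
            linarith
          have : a (0+1) = 0 := by simp only [ha]; rw [hh]; simp
          rw [this, ha0, sub_zero, norm_zero]
          positivity
        · have h2 : ((2 * m - 1 : ℕ) : ℝ) ≤ ((2 * m : ℕ) : ℝ) := by exact_mod_cast Nat.sub_le _ _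
          have h3 : ((2 * m : ℕ) : ℝ) < 2 * K := by push_cast; linarith
          refine (diff_bound x hx0 m hm1 (h (((2 * m : ℕ) : ℝ) / K)) (h (((2 * (m+1) : ℕ) : ℝ) / K)) M
            (hRJ _ (by linarith)) (hRJ _ h3)).trans ?_
          have hd : |h (((2 * (m+1) : ℕ) : ℝ) / K) - h (((2 * m : ℕ) : ℝ) / K)| ≤ 2 * Cb 1 * K ^ (-1 + ε) := by
            have := Convex.norm_image_sub_le_of_norm_deriv_le (𝕜 := ℝ) (f := h) (s := Set.univ)
              (C := Cb 1 * K ^ ε) (x := ((2 * m : ℕ) : ℝ) / K) (y := ((2 * (m+1) : ℕ) : ℝ) / K)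
              (fun u _ => (hsm.differentiable (by simp)).differentiableAt)
              (fun u _ => hb1 u) convex_univ (Set.mem_univ _) (Set.mem_univ _)
            rw [Real.norm_eq_abs] at this
            refine this.trans (le_of_eq ?_)
            have e : ((2 * (m+1) : ℕ) : ℝ) / K - ((2 * m : ℕ) : ℝ) / K = 2 / K := by
              push_cast; field_simp; ring
            rw [e, Real.norm_of_nonneg (by positivity), add_comm (-1) ε, Real.rpow_add hK0,
              Real.rpow_neg_one]
            ring
          have hq : 4 * (m:ℝ) / x ≤ 4 * K ^ (-1 + ε) := by
            rw [div_le_iff₀ hx0]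
            have e : K ^ (-1 + ε) * K ^ ((2:ℝ) - ε) = K := by
              rw [← Real.rpow_add hK0, show (-1 + ε) + ((2:ℝ) - ε) = 1 by ring, Real.rpow_one]
            have : K ^ (-1 + ε) * K ^ ((2:ℝ) - ε) ≤ K ^ (-1 + ε) * x :=
              mul_le_mul_of_nonneg_left hx.le (by positivity)
            linarith
          calc _ ≤ Cb 0 * (4 * K ^ (-1 + ε) * M) + 2 * Cb 1 * K ^ (-1 + ε) * M := by
                have := hb0 (((2 * (m+1) : ℕ) : ℝ) / K)
                gcongr
            _ = _ := by ring
      refine (Finset.sum_le_sum hterm).trans ?_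
      rw [Finset.sum_const, Finset.card_range, nsmul_eq_mul]
      have h2 : (n:ℝ) * ((4 * Cb 0 + 2 * Cb 1) * K ^ (-1 + ε) * M)
          ≤ (2 * K) * ((4 * Cb 0 + 2 * Cb 1) * K ^ (-1 + ε) * M) :=
        mul_le_mul_of_nonneg_right (by linarith) (by positivity)
      refine h2.trans (le_of_eq ?_)
      have e : K ^ (-1 + 3*ε/2) = K ^ (-1 + ε) * K ^ (-1 + ε/2) * K := by
        rw [← Real.rpow_add hK0, ← Real.rpow_add_one hK0.ne']; congr 1; ring
      rw [e, hM, hD]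
      ring
    have hfin := sum_bessel a n ha0 (hazero n le_rfl) _ _ y hA hB
    refine hfin.trans ?_
    have e1 : (D * K ^ (ε/2)) ^ ((1:ℝ)/60) * (D * K ^ (-1 + 3*ε/2)) ^ ((59:ℝ)/60)
        = D * K ^ (ε/2 * (1/60) + (-1 + 3*ε/2) * (59/60)) := by
      rw [Real.mul_rpow hD0 (by positivity), Real.mul_rpow hD0 (by positivity),
        ← Real.rpow_mul hK0.le, ← Real.rpow_mul hK0.le, Real.rpow_add hK0]
      have : D ^ ((1:ℝ)/60) * D ^ ((59:ℝ)/60) = D := by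
        rw [← Real.rpow_add_of_nonneg hD0 (by norm_num) (by norm_num)]; norm_num
      calc _ = (D ^ ((1:ℝ)/60) * D ^ ((59:ℝ)/60)) *
            (K ^ (ε/2 * (1/60)) * K ^ ((-1 + 3*ε/2) * (59/60))) := by ring
        _ = _ := by rw [this]
    rw [e1]
    have h5 : K ^ (ε/2 * (1/60) + (-1 + 3*ε/2) * (59/60)) ≤ K ^ (-(5:ℝ)/6) :=
      Real.rpow_le_rpow_of_exponent_le hK1 (by linarith)
    have h6 : 0 ≤ 272 * Cb 0 * K ^ (-(5:ℝ)/6) := by positivity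
    have h7 := mul_le_mul_of_nonneg_left h5 hD0
    linarith
end

section
/- Let ε > 0, D ∈ ℝ, A > 0 and a sequence of constants (C_B)_{B ≥ 0} be given. There exists a constant C, depending only on ε, D, A and the C_B, such that the following holds. Let N ≥ 2 be real, let c ≥ 1 be an integer, let Ψ: ℝ → ℂ be a smooth function supported on the interval (1,2) satisfying |Ψ^{(B)}(x)| ≤ C_B (N/c)^B N^{D − εB} for every integer B ≥ 0 and every x ∈ ℝ, and let S: ℤ → ℂ be periodic with period c, i.e. S(n + c) = S(n) for all n ∈ ℤ. Then |∑_{n ≥ 1} S(n) Ψ(n/N) − ( Ψ̂(0) N / c ) ∑_{a=0}^{c−1} S(a)| ≤ C · (max_{0 ≤ a < c} |S(a)|) · c · N^{−A}, where Ψ̂(0) = ∫_ℝ Ψ(x) dx. -/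
open MeasureTheory Filter FourierTransform in
theorem aux1 (q : ℝ) (hq : 0 < q) (Ψ : ℝ → ℂ) (hΨ : ContDiff ℝ (⊤ : ℕ∞) Ψ)
    (hs : Function.support Ψ ⊆ Set.Ioo 1 2) (B : ℕ) (hB : 2 ≤ B) (M : ℝ)
    (hM : ∀ x, ‖iteratedDeriv B Ψ x‖ ≤ M) (x : ℝ) :
    ‖(∑' m : ℤ, Ψ (q * (x + m))) - (q⁻¹ : ℝ) • ∫ v, Ψ v‖
      ≤ (q ^ B * q⁻¹ * M) * ∑' k : ℤ, 1 / (k : ℝ) ^ 2 := by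
  have hts : tsupport Ψ ⊆ Set.Icc 1 2 :=
    closure_minimal (hs.trans Set.Ioo_subset_Icc_self) isClosed_Icc
  have hcs : HasCompactSupport Ψ := isCompact_Icc.of_isClosed_subset (isClosed_tsupport _) hts
  set f : ℝ → ℂ := fun y => Ψ (q * y) with hf
  have hfc : ContDiff ℝ (⊤ : ℕ∞) f := hΨ.comp (contDiff_const.mul contDiff_id)
  have hfs : HasCompactSupport f := by
    have := hcs.comp_homeomorph (Homeomorph.mulLeft₀ q hq.ne')
    exact this
  have hint : ∀ n : ℕ, Integrable (iteratedDeriv n f) := by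
    intro n
    apply Continuous.integrable_of_hasCompactSupport
    · exact hfc.continuous_iteratedDeriv n (by exact_mod_cast le_top)
    · rw [iteratedDeriv_eq_equiv_comp]
      exact (hfs.iteratedFDeriv (𝕜 := ℝ) n).comp_left (map_zero _)
  have hd : iteratedDeriv B f = fun y => q ^ B • iteratedDeriv B Ψ (q * y) :=
    iteratedDeriv_comp_const_smul (hΨ.of_le (by exact_mod_cast le_top)) q
  have hL1 : ∫ y, ‖iteratedDeriv B f y‖ ≤ q ^ B * q⁻¹ * M := by
    rw [hd]
    simp only [norm_smul]
    rw [integral_const_mul, Measure.integral_comp_mul_left (fun v => ‖iteratedDeriv B Ψ v‖) q,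
      Real.norm_of_nonneg (by positivity), abs_of_pos (by positivity), smul_eq_mul, mul_assoc]
    gcongr
    have hsub : Function.support (fun v => ‖iteratedDeriv B Ψ v‖) ⊆ Set.Icc 1 2 := by
      intro v hv
      apply hts
      apply support_iteratedFDeriv_subset (𝕜 := ℝ) B
      intro h0
      apply hv
      simp only [iteratedDeriv_eq_iteratedFDeriv, h0]
      simp
    rw [← setIntegral_eq_integral_of_forall_compl_eq_zero (s := Set.Icc 1 2)
      (fun v hv => by by_contra h; exact hv (hsub h))]
    have := norm_setIntegral_le_of_norm_le_const (μ := volume) (s := Set.Icc (1:ℝ) 2)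
      (f := fun v => ‖iteratedDeriv B Ψ v‖) (C := M) (by simp) (fun v _ => by simpa using hM v)
    refine (le_abs_self _).trans (this.trans ?_)
    norm_num
  have hK0 : 0 ≤ q ^ B * q⁻¹ * M := le_trans (integral_nonneg fun _ => norm_nonneg _) hL1
  have hb : ∀ k : ℤ, k ≠ 0 → ‖𝓕 f (k : ℝ)‖ ≤ (q ^ B * q⁻¹ * M) * (1 / (k : ℝ) ^ 2) := by
    intro k hk
    have h1 := congrFun (Real.fourier_iteratedDeriv (N := ⊤) (n := B) hfc (fun n _ => hint n) le_top) (k : ℝ)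
    have h2 : ‖𝓕 (iteratedDeriv B f) (k : ℝ)‖ ≤ q ^ B * q⁻¹ * M :=
      (VectorFourier.norm_fourierIntegral_le_integral_norm _ _ _ _ _).trans hL1
    rw [h1, norm_smul, norm_pow] at h2
    have hk1 : (1 : ℝ) ≤ |(k : ℝ)| := by exact_mod_cast Int.one_le_abs hk
    have h3 : (k : ℝ) ^ 2 ≤ ‖2 * (Real.pi : ℂ) * Complex.I * ((k : ℝ) : ℂ)‖ ^ B := by
      simp only [norm_mul, Complex.norm_I, Complex.norm_real, Complex.norm_ofNat, Real.norm_eq_abs,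
        mul_one, abs_of_pos Real.pi_pos]
      have h4 : |(k : ℝ)| ≤ 2 * Real.pi * |(k : ℝ)| := by
        nlinarith [Real.pi_gt_three]
      calc (k : ℝ) ^ 2 = |(k : ℝ)| ^ 2 := (sq_abs _).symm
        _ ≤ |(k : ℝ)| ^ B := pow_le_pow_right₀ hk1 hB
        _ ≤ _ := by gcongr
    have hk2 : 0 < (k : ℝ) ^ 2 := by positivity
    rw [mul_one_div, le_div_iff₀ hk2, mul_comm]
    exact (mul_le_mul_of_nonneg_right h3 (norm_nonneg _)).trans h2
  have hP := SchwartzMap.tsum_eq_tsum_fourier (hfs.toSchwartzMap hfc) x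
  have hP' : ∑' n : ℤ, f (x + n) = ∑' n : ℤ, 𝓕 f n * fourier n (x : UnitAddCircle) := hP
  have hsum : Summable fun k : ℤ => (q ^ B * q⁻¹ * M) * (1 / (k : ℝ) ^ 2) :=
    (Real.summable_one_div_int_pow.2 one_lt_two).mul_left _
  have hnf : ∀ k : ℤ, ‖fourier k (x : UnitAddCircle)‖ = 1 := fun k => by
    rw [fourier_apply]; exact Circle.norm_coe _
  have hsum2 : Summable fun n : ℤ => 𝓕 f n * fourier n (x : UnitAddCircle) := by
    refine Summable.of_norm_bounded_eventually hsum ?_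
    refine (Set.finite_singleton (0:ℤ)).subset ?_
    intro k hk
    by_contra h0
    apply hk
    simp only [norm_mul, hnf, mul_one]
    exact hb k h0
  have h0 : 𝓕 f ((0 : ℤ) : ℝ) * fourier 0 (x : UnitAddCircle) = (q⁻¹ : ℝ) • ∫ v, Ψ v := by
    rw [_root_.fourier_zero, mul_one, Real.fourier_eq']
    simp only [Int.cast_zero, inner_zero_right, mul_zero, Complex.ofReal_zero, zero_mul,
      Complex.exp_zero, one_smul]
    rw [hf, Measure.integral_comp_mul_left Ψ q, abs_of_pos (by positivity)]
  change ‖(∑' m : ℤ, f (x + m)) - _‖ ≤ _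
  rw [hP', hsum2.tsum_eq_add_tsum_ite 0, h0, add_sub_cancel_left, ← tsum_mul_left]
  refine tsum_of_norm_bounded hsum.hasSum ?_
  intro k
  split_ifs with h
  · simp only [norm_zero]; positivity
  · simp only [norm_mul, hnf, mul_one]
    exact hb k h

theorem aux2 (N : ℝ) (hN : 0 < N) (c : ℕ) (hc : 1 ≤ c) (Ψ : ℝ → ℂ)
    (hs : Function.support Ψ ⊆ Set.Ioo 1 2) (S : ℤ → ℂ) (hS : ∀ n : ℤ, S (n + c) = S n) :
    (∑' n : ℕ, if 1 ≤ n then S n * Ψ ((n : ℝ) / N) else 0)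
      = ∑ a ∈ Finset.range c, S a * ∑' m : ℤ, Ψ ((c / N) * ((a : ℝ) / c + m)) := by
  have : NeZero c := ⟨by omega⟩
  have hz : ∀ x, x ∉ Set.Ioo (1:ℝ) 2 → Ψ x = 0 := fun x hx => by
    by_contra h; exact hx (hs h)
  set F : ℤ → ℂ := fun n => S n * Ψ ((n : ℝ) / N) with hF
  have hfin : (Function.support F).Finite := by
    refine (Set.finite_Icc (0:ℤ) ⌈2 * N⌉).subset ?_
    intro n hn
    have h1 : Ψ ((n : ℝ) / N) ≠ 0 := fun h => hn (by simp [hF, h])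
    have h2 := hs h1
    rw [Set.mem_Ioo, lt_div_iff₀ hN, div_lt_iff₀ hN] at h2
    constructor
    · have : (0:ℝ) < n := by linarith
      exact_mod_cast this.le
    · have := Int.le_ceil (2 * N)
      exact_mod_cast (h2.2.le.trans this)
  have hsumm : Summable F := summable_of_hasFiniteSupport hfin
  have h1 : (∑' n : ℕ, if 1 ≤ n then S n * Ψ ((n : ℝ) / N) else 0) = ∑' n : ℕ, F (n : ℤ) := by
    congr 1; ext n
    split_ifs with h
    · simp [hF]
    · have : n = 0 := by omega
      subst this
      simp [hF, hz 0 (by norm_num)]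
  rw [h1, Nat.cast_injective.tsum_eq (f := F) (by
    intro n hn
    have h1 : Ψ ((n : ℝ) / N) ≠ 0 := fun h => hn (by simp [hF, h])
    have h2 := hs h1
    rw [Set.mem_Ioo, lt_div_iff₀ hN] at h2
    have : (0:ℝ) < n := by linarith
    have h3 : 0 ≤ n := by exact_mod_cast this.le
    exact ⟨n.toNat, by simp [h3]⟩)]
  have hper : ∀ (m n : ℤ), S (n + m * c) = S n := fun m n => by
    have : Function.Periodic S (c : ℤ) := hS
    simpa using this.int_mul m n
  rw [← (Int.divModEquiv c).symm.tsum_eq F, ← (Equiv.prodComm _ _).tsum_eq]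
  have hs2 : Summable fun p : Fin c × ℤ => F ((Int.divModEquiv c).symm (Equiv.prodComm _ _ p)) := by
    exact hsumm.comp_injective ((Int.divModEquiv c).symm.injective.comp (Equiv.prodComm _ _).injective)
  rw [hs2.tsum_prod, tsum_fintype, Finset.sum_range]
  refine Finset.sum_congr rfl fun a _ => ?_
  rw [← tsum_mul_left]
  congr 1; ext m
  have hc0 : (c : ℝ) ≠ 0 := by positivity
  simp only [Equiv.prodComm_apply, Prod.swap_prod_mk, hF, Int.divModEquiv_symm_apply]
  have e : S (m * c + ((a : ℕ) : ℤ)) = S ((a : ℕ) : ℤ) := by rw [add_comm]; exact hper _ _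
  rw [show ((c : ℝ) / N) * (((a : ℕ) : ℝ) / c + m) = ((m * c + ((a : ℕ) : ℤ) : ℤ) : ℝ) / N by
    push_cast; field_simp; ring]
  rw [← e]

theorem stmt4 (ε D A : ℝ) (hε : 0 < ε) (hA : 0 < A) (Cb : ℕ → ℝ) :
    ∃ C : ℝ, ∀ N : ℝ, 2 ≤ N → ∀ c : ℕ, 1 ≤ c → ∀ Ψ : ℝ → ℂ,
      ContDiff ℝ (⊤ : ℕ∞) Ψ →
      Function.support Ψ ⊆ Set.Ioo 1 2 →
      (∀ (B : ℕ) (x : ℝ), ‖iteratedDeriv B Ψ x‖ ≤ Cb B * (N / c) ^ B * N ^ (D - ε * B)) →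
      ∀ S : ℤ → ℂ, (∀ n : ℤ, S (n + c) = S n) →
      ‖(∑' n : ℕ, if 1 ≤ n then S n * Ψ ((n : ℝ) / N) else 0)
          - fhat Ψ 0 * (N : ℂ) / (c : ℂ) * ∑ a ∈ Finset.range c, S a‖
        ≤ C * (⨆ a : Fin c, ‖S ((a : ℕ) : ℤ)‖) * c * N ^ (-A) := by
  obtain ⟨B, hB2, hB⟩ : ∃ B : ℕ, 2 ≤ B ∧ D + 1 + A ≤ ε * B := by
    obtain ⟨n, hn⟩ := exists_nat_ge ((D + 1 + A) / ε)
    refine ⟨max 2 n, le_max_left _ _, ?_⟩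
    rw [div_le_iff₀ hε] at hn
    have : (n : ℝ) ≤ (max 2 n : ℕ) := by exact_mod_cast le_max_right _ _
    nlinarith
  set Z : ℝ := ∑' k : ℤ, 1 / (k : ℝ) ^ 2 with hZ
  have hZ0 : 0 ≤ Z := tsum_nonneg fun k => by positivity
  refine ⟨|Cb B| * Z, ?_⟩
  intro N hN c hc Ψ hΨ hs hbd S hS
  have hN0 : 0 < N := by linarith
  have hc1 : (1 : ℝ) ≤ c := by exact_mod_cast hc
  have hc0 : (0 : ℝ) < c := by linarith
  have key : ∀ a : ℕ, ‖(∑' m : ℤ, Ψ ((c / N) * ((a : ℝ) / c + m))) - fhat Ψ 0 * (N : ℂ) / (c : ℂ)‖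
      ≤ |Cb B| * Z * N ^ (-A) := by
    intro a
    have h := aux1 (c / N) (by positivity) Ψ hΨ hs B hB2 _ (hbd B) ((a : ℝ) / c)
    have e : ((c / N : ℝ)⁻¹ : ℝ) • ∫ v, Ψ v = fhat Ψ 0 * (N : ℂ) / (c : ℂ) := by
      simp [fhat, ee, Complex.real_smul]
      ring
    rw [e] at h
    refine h.trans ?_
    rw [← hZ]
    have e2 : (c / N : ℝ) ^ B * (c / N : ℝ)⁻¹ * (Cb B * (N / c) ^ B * N ^ (D - ε * B))
        = Cb B * (N ^ (D - ε * B) * N) / c := by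
      have : (c / N : ℝ) ^ B * (N / c) ^ B = 1 := by
        rw [← mul_pow]; field_simp; simp
      calc _ = ((c / N : ℝ) ^ B * (N / c) ^ B) * ((c / N : ℝ)⁻¹ * Cb B * N ^ (D - ε * B)) := by ring
        _ = _ := by rw [this, inv_div]; ring
    rw [e2]
    have e3 : N ^ (D - ε * B) * N ≤ N ^ (-A) := by
      rw [← Real.rpow_add_one hN0.ne']
      exact Real.rpow_le_rpow_of_exponent_le (by linarith) (by linarith)
    have e4 : Cb B * (N ^ (D - ε * B) * N) / c ≤ |Cb B| * N ^ (-A) := by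
      rw [div_le_iff₀ hc0]
      calc Cb B * (N ^ (D - ε * B) * N) ≤ |Cb B| * N ^ (-A) := by
            gcongr
            exact le_abs_self _
        _ ≤ _ := le_mul_of_one_le_right (by positivity) hc1
    calc _ ≤ |Cb B| * N ^ (-A) * Z := by gcongr
      _ = _ := by ring
  rw [aux2 N hN0 c hc Ψ hs S hS, Finset.mul_sum, ← Finset.sum_sub_distrib]
  refine (norm_sum_le _ _).trans ?_
  have hterm : ∀ a ∈ Finset.range c,
      ‖S a * (∑' m : ℤ, Ψ ((c / N) * ((a : ℝ) / c + m))) - fhat Ψ 0 * (N : ℂ) / (c : ℂ) * S a‖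
      ≤ (⨆ a : Fin c, ‖S ((a : ℕ) : ℤ)‖) * (|Cb B| * Z * N ^ (-A)) := by
    intro a ha
    rw [mul_comm (fhat Ψ 0 * (N : ℂ) / (c : ℂ)), ← mul_sub, norm_mul]
    have h5 : ‖S a‖ ≤ ⨆ a : Fin c, ‖S ((a : ℕ) : ℤ)‖ :=
      le_ciSup (f := fun a : Fin c => ‖S ((a : ℕ) : ℤ)‖) (Set.finite_range _).bddAbove
        ⟨a, Finset.mem_range.1 ha⟩
    exact mul_le_mul h5 (key a) (norm_nonneg _) ((norm_nonneg _).trans h5)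
  refine (Finset.sum_le_card_nsmul _ _ _ hterm).trans (le_of_eq ?_)
  rw [Finset.card_range, nsmul_eq_mul]
  ring
end
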